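/- arXiv:1806.06325 — 2 statements merged into one kernel-verified Lean document; each statement's English description precedes it below -/
import Mathlib

section
/- Let s, l, m be integers with l ≥ max(|s|, |s−1|) and |m| ≤ l. Then applying the spin-lowering operator at spin weight s to the spin-weighted spherical harmonic Y_{s,lm} gives ð̄ Y_{s,lm} = −√((l+s)(l−s+1))·Y_{s−1,lm} on the open set 0 < θ < π. -/
open scoped Real
open Complex

noncomputable section

/-- Legendre polynomial `P_l` via Rodrigues' formula. -/
def legendreP (l : ℕ) (x : ℝ) : ℝ :=
  (1 / (2 ^ l * (Nat.factorial l : ℝ))) * iteratedDeriv l (fun y => (y ^ 2 - 1) ^ l) x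

/-- Associated Legendre function `P_l^m` for `0 ≤ m ≤ l`. -/
def assocLegendreNat (l m : ℕ) (x : ℝ) : ℝ :=
  (-1 : ℝ) ^ m * (Real.sqrt (1 - x ^ 2)) ^ m * iteratedDeriv m (legendreP l) x

/-- Associated Legendre function `P_l^m` for integer `m`
    (negative `m` via `P_l^{-m} = (-1)^m ((l-m)!/(l+m)!) P_l^m`). -/
def assocLegendre (l : ℕ) (m : ℤ) (x : ℝ) : ℝ :=
  if 0 ≤ m then assocLegendreNat l m.toNat x
  else
    (-1 : ℝ) ^ m.natAbs *
      ((Nat.factorial (l - m.natAbs) : ℝ) / (Nat.factorial (l + m.natAbs) : ℝ)) *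
      assocLegendreNat l m.natAbs x

/-- Spherical harmonic `Y_{lm}(θ,φ)`; by convention it is `0` when `l < 0` or `|m| > l`. -/
def sphHarm (l m : ℤ) (θ φ : ℝ) : ℂ :=
  if 0 ≤ l ∧ |m| ≤ l then
    ((Real.sqrt ((2 * (l : ℝ) + 1) / (4 * Real.pi) *
        ((Nat.factorial (l - m).toNat : ℝ) / (Nat.factorial (l + m).toNat : ℝ))) *
      assocLegendre l.toNat m (Real.cos θ) : ℝ) : ℂ) *
      Complex.exp (Complex.I * (m : ℂ) * (φ : ℂ))
  else 0

/-- Spin-weighted spherical harmonic `Y_{s,lm}(θ,φ)`;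
    by convention it is `0` when `l < |s|` or `|m| > l`. -/
def spinSphHarm (s l m : ℤ) (θ φ : ℝ) : ℂ :=
  if |s| ≤ l ∧ |m| ≤ l then
    ((Real.sqrt ((2 * (l : ℝ) + 1) / (4 * Real.pi) *
          ((Nat.factorial (l + m).toNat : ℝ) * (Nat.factorial (l - m).toNat : ℝ)) /
          ((Nat.factorial (l + s).toNat : ℝ) * (Nat.factorial (l - s).toNat : ℝ))) *
        Real.sin (θ / 2) ^ (2 * l).toNat : ℝ) : ℂ) *
      Complex.exp (Complex.I * (m : ℂ) * (φ : ℂ)) *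
      ∑ r ∈ Finset.Icc (0 : ℤ) (l - s),
        if 0 ≤ r + s - m ∧ r + s - m ≤ l + s then
          ((((l - s).toNat.choose r.toNat : ℝ) * ((l + s).toNat.choose (r + s - m).toNat : ℝ) : ℝ) : ℂ) *
            (-1 : ℂ) ^ (l - r - s) * ((((Real.tan (θ / 2))⁻¹ : ℝ) ^ (2 * r + s - m) : ℝ) : ℂ)
        else 0
  else 0

/-- Integral of a function over the sphere: `∫ f dΩ = ∫₀^{2π} ∫₀^π f(θ,φ) sin θ dθ dφ`. -/
def sphereIntegral (f : ℝ → ℝ → ℂ) : ℂ :=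
  ∫ φ in (0 : ℝ)..(2 * Real.pi), ∫ θ in (0 : ℝ)..Real.pi, f θ φ * ((Real.sin θ : ℝ) : ℂ)

/-- The spin-raising operator `ð` acting on a function of spin weight `s`:
    `ð η = -(sin θ)^s (∂_θ + (i / sin θ) ∂_φ) ((sin θ)^{-s} η)`. -/
def eth (s : ℤ) (η : ℝ → ℝ → ℂ) : ℝ → ℝ → ℂ := fun θ φ =>
  -(((Real.sin θ : ℝ) : ℂ) ^ s) *
    (deriv (fun t => (((Real.sin t : ℝ) : ℂ) ^ (-s)) * η t φ) θ +
      (Complex.I / ((Real.sin θ : ℝ) : ℂ)) *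
        deriv (fun p => (((Real.sin θ : ℝ) : ℂ) ^ (-s)) * η θ p) φ)

/-- The spin-lowering operator `ð̄` acting on a function of spin weight `s`:
    `ð̄ η = -(sin θ)^{-s} (∂_θ - (i / sin θ) ∂_φ) ((sin θ)^s η)`. -/
def ethBar (s : ℤ) (η : ℝ → ℝ → ℂ) : ℝ → ℝ → ℂ := fun θ φ =>
  -(((Real.sin θ : ℝ) : ℂ) ^ (-s)) *
    (deriv (fun t => (((Real.sin t : ℝ) : ℂ) ^ s) * η t φ) θ -
      (Complex.I / ((Real.sin θ : ℝ) : ℂ)) *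
        deriv (fun p => (((Real.sin θ : ℝ) : ℂ) ^ s) * η θ p) φ)

end

/-- Binomial coefficient with integer arguments, zero for negative lower argument. -/
noncomputable def intChoose (n k : ℤ) : ℝ := if 0 ≤ k then (n.toNat.choose k.toNat : ℝ) else 0

lemma intChoose_of_neg {n k : ℤ} (hk : k < 0) : intChoose n k = 0 := by
  simp [intChoose, not_le.mpr hk]

lemma intChoose_natCast (n k : ℕ) : intChoose n k = (n.choose k : ℝ) := by
  simp [intChoose]

lemma intChoose_of_lt {n k : ℤ} (hn : 0 ≤ n) (hk : n < k) : intChoose n k = 0 := by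
  lift n to ℕ using hn
  lift k to ℕ using by omega
  rw [intChoose_natCast, Nat.choose_eq_zero_of_lt (by omega), Nat.cast_zero]

lemma intChoose_succ {n : ℤ} (hn : 0 ≤ n) (k : ℤ) :
    intChoose (n + 1) k = intChoose n (k - 1) + intChoose n k := by
  lift n to ℕ using hn
  rcases lt_trichotomy k 0 with hk | rfl | hk
  · rw [intChoose_of_neg hk, intChoose_of_neg hk, intChoose_of_neg (by omega), add_zero]
  · rw [intChoose_of_neg (k := 0 - 1) (by omega)]
    simp [intChoose]
  · obtain ⟨j, rfl⟩ : ∃ j : ℕ, k = j + 1 := ⟨(k - 1).toNat, by omega⟩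
    rw [add_sub_cancel_right]
    have := Nat.choose_succ_succ n j
    have h1 := intChoose_natCast (n + 1) (j + 1)
    have h2 := intChoose_natCast n (j + 1)
    push_cast at h1 h2
    rw [h1, h2, intChoose_natCast, this]
    push_cast
    ring

lemma mul_intChoose {n : ℤ} (hn : 1 ≤ n) (k : ℤ) :
    (k : ℝ) * intChoose n k = n * intChoose (n - 1) (k - 1) := by
  obtain ⟨n, rfl⟩ : ∃ j : ℕ, n = j + 1 := ⟨(n - 1).toNat, by omega⟩
  rcases lt_trichotomy k 0 with hk | rfl | hk
  · rw [intChoose_of_neg hk, intChoose_of_neg (by omega), mul_zero, mul_zero]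
  · rw [intChoose_of_neg (k := 0 - 1) (by omega)]
    simp
  · obtain ⟨j, rfl⟩ : ∃ j : ℕ, k = j + 1 := ⟨(k - 1).toNat, by omega⟩
    rw [add_sub_cancel_right, add_sub_cancel_right, intChoose_natCast]
    have h1 := intChoose_natCast (n + 1) (j + 1)
    have h2 : ((n + 1 : ℕ) : ℝ) * (n.choose j : ℝ) = ((n + 1).choose (j + 1) : ℝ) * (j + 1 : ℕ) :=
      mod_cast Nat.add_one_mul_choose_eq n j
    push_cast at h1 h2 ⊢
    rw [h1, h2, mul_comm]

lemma sub_mul_intChoose {n : ℤ} (hn : 1 ≤ n) (k : ℤ) :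
    ((n : ℝ) - k) * intChoose n k = n * intChoose (n - 1) k := by
  have h1 := intChoose_succ (n := n - 1) (by omega) k
  rw [sub_add_cancel] at h1
  rw [sub_mul, mul_intChoose hn, h1]
  ring

/-- Coefficient of `cos (θ/2) ^ (2r+s-m) * sin (θ/2) ^ (2l-(2r+s-m))` in the polynomial part of
the spin-weighted spherical harmonic. -/
noncomputable def spinCoeff (s l m r : ℤ) : ℝ :=
  intChoose (l - s) r * intChoose (l + s) (r + s - m) * (-1) ^ (l - r - s)

/-- The basic half-angle function `cos (θ/2) ^ p * sin (θ/2) ^ q`. -/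
noncomputable def halfAngle (p q : ℤ) (θ : ℝ) : ℝ := Real.cos (θ / 2) ^ p * Real.sin (θ / 2) ^ q

/-- The unnormalised `θ`-dependence of the spin-weighted spherical harmonic. -/
noncomputable def spinPolar (s l m : ℤ) (θ : ℝ) : ℝ :=
  ∑ r ∈ Finset.Icc (0 : ℤ) (l - s),
    spinCoeff s l m r * halfAngle (2 * r + s - m) (2 * l - (2 * r + s - m)) θ

/-- The normalisation constant of the spin-weighted spherical harmonic. -/
noncomputable def spinNorm (s l m : ℤ) : ℝ :=
  Real.sqrt ((2 * (l : ℝ) + 1) / (4 * Real.pi) *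
    ((Nat.factorial (l + m).toNat : ℝ) * (Nat.factorial (l - m).toNat : ℝ)) /
    ((Nat.factorial (l + s).toNat : ℝ) * (Nat.factorial (l - s).toNat : ℝ)))

lemma sin_half_pos {θ : ℝ} (h0 : 0 < θ) (hπ : θ < Real.pi) : 0 < Real.sin (θ / 2) :=
  Real.sin_pos_of_pos_of_lt_pi (by linarith) (by linarith)

lemma cos_half_pos {θ : ℝ} (h0 : 0 < θ) (hπ : θ < Real.pi) : 0 < Real.cos (θ / 2) :=
  Real.cos_pos_of_mem_Ioo ⟨by linarith, by linarith⟩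

lemma spinSphHarm_eq {s l m : ℤ} (hs : |s| ≤ l) (hm : |m| ≤ l) {θ : ℝ} (h0 : 0 < θ)
    (hπ : θ < Real.pi) (φ : ℝ) :
    spinSphHarm s l m θ φ =
      ((spinNorm s l m * spinPolar s l m θ : ℝ) : ℂ) * Complex.exp (Complex.I * m * φ) := by
  have hS := sin_half_pos h0 hπ
  have hC := cos_half_pos h0 hπ
  have hs' := abs_le.mp hs
  have key : ∀ r ∈ Finset.Icc (0 : ℤ) (l - s),
      ((Real.sin (θ / 2) ^ (2 * l).toNat : ℝ) : ℂ) *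
        (if 0 ≤ r + s - m ∧ r + s - m ≤ l + s then
          ((((l - s).toNat.choose r.toNat : ℝ) *
            ((l + s).toNat.choose (r + s - m).toNat : ℝ) : ℝ) : ℂ) *
            (-1 : ℂ) ^ (l - r - s) * ((((Real.tan (θ / 2))⁻¹ : ℝ) ^ (2 * r + s - m) : ℝ) : ℂ)
        else 0) =
      ((spinCoeff s l m r * halfAngle (2 * r + s - m) (2 * l - (2 * r + s - m)) θ : ℝ) : ℂ) := by
    intro r hr
    have hr0 := (Finset.mem_Icc.mp hr).1
    split_ifs with h
    · have e : Real.sin (θ / 2) ^ (2 * l).toNat * (Real.tan (θ / 2))⁻¹ ^ (2 * r + s - m) =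
          halfAngle (2 * r + s - m) (2 * l - (2 * r + s - m)) θ := by
        rw [halfAngle, zpow_sub₀ hS.ne', Real.tan_eq_sin_div_cos, inv_div, div_zpow,
          ← zpow_natCast, Int.toNat_of_nonneg (by omega)]
        ring
      rw [spinCoeff, intChoose, intChoose, if_pos hr0, if_pos h.1, ← e]
      push_cast
      ring
    · rw [spinCoeff]
      have : intChoose (l + s) (r + s - m) = 0 := by
        by_cases h1 : 0 ≤ r + s - m
        · exact intChoose_of_lt (by omega) (by omega)
        · exact intChoose_of_neg (by omega)
      simp [this]
  rw [spinSphHarm, if_pos ⟨hs, hm⟩, spinPolar, Complex.ofReal_mul (spinNorm s l m),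
    Complex.ofReal_sum, ← Finset.sum_congr rfl key, ← Finset.mul_sum, Complex.ofReal_mul, spinNorm]
  ring

lemma hasDerivAt_halfAngle (p q : ℤ) {θ : ℝ} (h0 : 0 < θ) (hπ : θ < Real.pi) :
    HasDerivAt (halfAngle p q)
      (q / 2 * halfAngle (p + 1) (q - 1) θ - p / 2 * halfAngle (p - 1) (q + 1) θ) θ := by
  have hS := sin_half_pos h0 hπ
  have hC := cos_half_pos h0 hπ
  have hhalf : HasDerivAt (fun t : ℝ => t / 2) (1 / 2) θ := (hasDerivAt_id θ).div_const 2
  have h1 := (hasDerivAt_zpow p _ (Or.inl hC.ne')).comp θ hhalf.cos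
  have h2 := (hasDerivAt_zpow q _ (Or.inl hS.ne')).comp θ hhalf.sin
  refine (h1.mul h2).congr_deriv ?_
  simp only [halfAngle, Function.comp_apply, zpow_add_one₀ hS.ne', zpow_add_one₀ hC.ne']
  ring

lemma lowering_halfAngle (s m p q : ℤ) {θ : ℝ} (h0 : 0 < θ) (hπ : θ < Real.pi) :
    (q / 2 * halfAngle (p + 1) (q - 1) θ - p / 2 * halfAngle (p - 1) (q + 1) θ) +
        (s * Real.cos θ + m) / Real.sin θ * halfAngle p q θ =
      (q + s + m) / 2 * halfAngle (p + 1) (q - 1) θ -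
        (p + s - m) / 2 * halfAngle (p - 1) (q + 1) θ := by
  have hS := sin_half_pos h0 hπ
  have hC := cos_half_pos h0 hπ
  have e1 : Real.sin θ = 2 * Real.sin (θ / 2) * Real.cos (θ / 2) := by
    rw [← Real.sin_two_mul]; ring_nf
  have e2 : Real.cos θ = Real.cos (θ / 2) ^ 2 - Real.sin (θ / 2) ^ 2 := by
    rw [← Real.cos_two_mul']; ring_nf
  have e3 := Real.sin_sq_add_cos_sq (θ / 2)
  have e4 : (s * Real.cos θ + m) =
      (s + m) * Real.cos (θ / 2) ^ 2 + (m - s) * Real.sin (θ / 2) ^ 2 := by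
    rw [e2]; linear_combination -(m : ℝ) * e3
  rw [e4, e1]
  simp only [halfAngle, zpow_add_one₀ hS.ne', zpow_add_one₀ hC.ne', zpow_sub_one₀ hS.ne',
    zpow_sub_one₀ hC.ne']
  field_simp
  ring

lemma spinCoeff_lowering {s l : ℤ} (h1 : 1 ≤ l + s) (h2 : 0 ≤ l - s) (m r : ℤ) :
    spinCoeff s l m (r - 1) * (l - (r - 1) + m) - spinCoeff s l m r * (r + s - m) =
      (l + s) * spinCoeff (s - 1) l m r := by
  have hp := intChoose_succ h2 r
  have hk := mul_intChoose h1 (r + s - m)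
  have hj := sub_mul_intChoose h1 (r + s - m - 1)
  have z1 : ((-1 : ℝ)) ^ (l - (r - 1) - s) = -(-1) ^ (l - r - s) := by
    rw [show l - (r - 1) - s = l - r - s + 1 by ring, zpow_add_one₀ (by norm_num)]; ring
  have z2 : ((-1 : ℝ)) ^ (l - r - (s - 1)) = -(-1) ^ (l - r - s) := by
    rw [show l - r - (s - 1) = l - r - s + 1 by ring, zpow_add_one₀ (by norm_num)]; ring
  rw [spinCoeff, spinCoeff, spinCoeff, z1, z2, show l - (s - 1) = l - s + 1 by ring, hp,
    show r - 1 + s - m = r + s - m - 1 by ring, show l + (s - 1) = l + s - 1 by ring,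
    show r + (s - 1) - m = r + s - m - 1 by ring]
  push_cast at hk hj
  linear_combination (-(-1 : ℝ) ^ (l - r - s)) * intChoose (l - s) (r - 1) * hj
    - (-1 : ℝ) ^ (l - r - s) * intChoose (l - s) r * hk

lemma hasDerivAt_spinPolar {s l : ℤ} (h1 : 1 ≤ l + s) (h2 : 0 ≤ l - s) (m : ℤ) {θ : ℝ}
    (h0 : 0 < θ) (hπ : θ < Real.pi) :
    HasDerivAt (spinPolar s l m)
      ((l + s) * spinPolar (s - 1) l m θ -
        (s * Real.cos θ + m) / Real.sin θ * spinPolar s l m θ) θ := by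
  have hd : HasDerivAt (spinPolar s l m) _ θ :=
    HasDerivAt.fun_sum fun r (_ : r ∈ Finset.Icc (0 : ℤ) (l - s)) =>
      (hasDerivAt_halfAngle (2 * r + s - m) (2 * l - (2 * r + s - m)) h0 hπ).const_mul
        (spinCoeff s l m r)
  refine hd.congr_deriv (eq_sub_of_add_eq ?_)
  rw [spinPolar, Finset.mul_sum, ← Finset.sum_add_distrib]
  set F : ℤ → ℝ := fun r =>
    halfAngle (2 * r + (s - 1) - m) (2 * l - (2 * r + (s - 1) - m)) θ with hF
  have hterm : ∀ r : ℤ,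
      spinCoeff s l m r * (((2 * l - (2 * r + s - m) : ℤ) : ℝ) / 2 *
          halfAngle (2 * r + s - m + 1) (2 * l - (2 * r + s - m) - 1) θ -
        ((2 * r + s - m : ℤ) : ℝ) / 2 *
          halfAngle (2 * r + s - m - 1) (2 * l - (2 * r + s - m) + 1) θ) +
      (s * Real.cos θ + m) / Real.sin θ *
        (spinCoeff s l m r * halfAngle (2 * r + s - m) (2 * l - (2 * r + s - m)) θ) =
      spinCoeff s l m r * (l - r + m) * F (r + 1) - spinCoeff s l m r * (r + s - m) * F r := by
    intro r
    have := lowering_halfAngle s m (2 * r + s - m) (2 * l - (2 * r + s - m)) h0 hπ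
    simp only [hF]
    rw [show 2 * (r + 1) + (s - 1) - m = 2 * r + s - m + 1 by ring,
      show 2 * r + (s - 1) - m = 2 * r + s - m - 1 by ring,
      show 2 * l - (2 * r + s - m + 1) = 2 * l - (2 * r + s - m) - 1 by ring,
      show 2 * l - (2 * r + s - m - 1) = 2 * l - (2 * r + s - m) + 1 by ring]
    push_cast at this ⊢
    linear_combination spinCoeff s l m r * this
  have hshift : ∑ r ∈ Finset.Icc (0 : ℤ) (l - s), spinCoeff s l m r * (l - r + m) * F (r + 1) =
      ∑ r ∈ Finset.Icc (0 : ℤ) (l - s + 1),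
        spinCoeff s l m (r - 1) * (l - (r - 1) + m) * F r := by
    rw [← Finset.sum_subset (s₂ := Finset.Icc (0 : ℤ) (l - s + 1))
        (Finset.Icc_subset_Icc_left (by omega : (0 : ℤ) ≤ 0 + 1)),
      ← Finset.image_add_right_Icc, Finset.sum_image (by simp)]
    · simp
    · intro r hr hr'
      rw [Finset.mem_Icc] at hr hr'
      simp [spinCoeff, intChoose_of_neg (show r - 1 < 0 by omega)]
  have hext : ∑ r ∈ Finset.Icc (0 : ℤ) (l - s), spinCoeff s l m r * (r + s - m) * F r =
      ∑ r ∈ Finset.Icc (0 : ℤ) (l - s + 1), spinCoeff s l m r * (r + s - m) * F r := by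
    refine Finset.sum_subset (Finset.Icc_subset_Icc_right (by omega)) fun r hr hr' => ?_
    rw [Finset.mem_Icc] at hr hr'
    simp [spinCoeff, intChoose_of_lt h2 (show l - s < r by omega)]
  rw [Finset.sum_congr rfl fun r _ => hterm r, Finset.sum_sub_distrib, hshift, hext,
    ← Finset.sum_sub_distrib, spinPolar, Finset.mul_sum, show l - (s - 1) = l - s + 1 by ring]
  refine Finset.sum_congr rfl fun r _ => ?_
  rw [← sub_mul, spinCoeff_lowering h1 h2, mul_assoc]

lemma spinNorm_lowering {s l : ℤ} (h1 : 1 ≤ l + s) (h2 : 0 ≤ l - s) (m : ℤ) :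
    spinNorm s l m * (l + s) =
      Real.sqrt (((l : ℝ) + s) * ((l : ℝ) - s + 1)) * spinNorm (s - 1) l m := by
  have ha : (0 : ℝ) < l + s := mod_cast (by omega : 0 < l + s)
  have hb : (0 : ℝ) < l - s + 1 := mod_cast (by omega : 0 < l - s + 1)
  have f1 : (Nat.factorial (l + s).toNat : ℝ) =
      (l + s) * (Nat.factorial (l + (s - 1)).toNat : ℝ) := by
    obtain ⟨k, hk⟩ : ∃ k : ℕ, l + s = k + 1 := ⟨(l + s - 1).toNat, by omega⟩
    have hk' : (l : ℝ) + s = k + 1 := mod_cast hk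
    rw [show (l + s).toNat = k + 1 by omega, show (l + (s - 1)).toNat = k by omega, hk',
      Nat.factorial_succ]
    push_cast
    rfl
  have f2 : (Nat.factorial (l - (s - 1)).toNat : ℝ) =
      (l - s + 1) * (Nat.factorial (l - s).toNat : ℝ) := by
    obtain ⟨k, hk⟩ : ∃ k : ℕ, l - s = k := ⟨(l - s).toNat, by omega⟩
    have hk' : (l : ℝ) - s = k := mod_cast hk
    rw [show (l - (s - 1)).toNat = k + 1 by omega, show (l - s).toNat = k by omega, hk',
      Nat.factorial_succ]
    push_cast
    rfl
  rw [spinNorm, spinNorm, ← Real.sqrt_mul (by positivity), f1, f2]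
  nth_rw 2 [← Real.sqrt_sq ha.le]
  rw [← Real.sqrt_mul' _ (by positivity)]
  congr 1
  field_simp

lemma ethBar_of_eventuallyEq {s m : ℤ} {η : ℝ → ℝ → ℂ} {h : ℝ → ℝ} {h' θ : ℝ}
    (hη : ∀ᶠ t in nhds θ, ∀ φ : ℝ, η t φ = (h t : ℂ) * Complex.exp (Complex.I * m * φ))
    (hd : HasDerivAt h h' θ) (hθ : Real.sin θ ≠ 0) (φ : ℝ) :
    ethBar s η θ φ =
      -((h' + (s * Real.cos θ + m) / Real.sin θ * h θ : ℝ) : ℂ) *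
        Complex.exp (Complex.I * m * φ) := by
  have hθ' : ((Real.sin θ : ℝ) : ℂ) ≠ 0 := mod_cast hθ
  have d1 : HasDerivAt (fun t => (((Real.sin t : ℝ) : ℂ) ^ s) * η t φ)
      ((((s * Real.sin θ ^ (s - 1) * Real.cos θ) * h θ + Real.sin θ ^ s * h' : ℝ) : ℂ) *
        Complex.exp (Complex.I * m * φ)) θ := by
    have hz := ((hasDerivAt_zpow s _ (Or.inl hθ)).comp θ (Real.hasDerivAt_sin θ)).mul hd
    refine (hz.ofReal_comp.mul_const (Complex.exp (Complex.I * m * φ))).congr_of_eventuallyEq ?_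
    filter_upwards [hη] with t ht
    rw [ht φ]
    simp [mul_assoc]
  have d2 : HasDerivAt (fun p : ℝ => (((Real.sin θ : ℝ) : ℂ) ^ s) * η θ p)
      (((Real.sin θ : ℝ) : ℂ) ^ s *
        ((h θ : ℂ) * (Complex.exp (Complex.I * m * φ) * (Complex.I * m)))) φ := by
    have hl : HasDerivAt (fun p : ℝ => Complex.I * m * (p : ℂ)) (Complex.I * m) φ := by
      simpa using (Complex.ofRealCLM.hasDerivAt (x := φ)).const_mul (Complex.I * m)
    simp only [hη.self_of_nhds]
    exact (hl.cexp.const_mul _).const_mul _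
  rw [ethBar, d1.deriv, d2.deriv, zpow_neg]
  push_cast
  rw [zpow_sub_one₀ (by exact_mod_cast hθ')]
  have hz : (Complex.sin θ) ^ s ≠ 0 := zpow_ne_zero _ (by exact_mod_cast hθ')
  have hs : Complex.sin θ ≠ 0 := by exact_mod_cast hθ'
  field_simp
  linear_combination ((m : ℂ) * h θ) * Complex.I_sq

/-- **Action of the spin-lowering operator on spin-weighted spherical harmonics:**
`ð̄ Y_{s,lm} = -√((l+s)(l-s+1)) Y_{s-1,lm}` for `0 < θ < π`. -/
theorem ethBar_spinSphHarm
    (s l m : ℤ) (hl : max |s| |s - 1| ≤ l) (hm : |m| ≤ l) :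
    ∀ θ φ : ℝ, 0 < θ → θ < Real.pi →
      ethBar s (spinSphHarm s l m) θ φ =
        -((Real.sqrt (((l : ℝ) + (s : ℝ)) * ((l : ℝ) - (s : ℝ) + 1)) : ℝ) : ℂ) *
          spinSphHarm (s - 1) l m θ φ := by
  intro θ φ h0 hπ
  obtain ⟨hs, hs1⟩ := max_le_iff.mp hl
  have h1 : 1 ≤ l + s := by have := abs_le.mp hs1; omega
  have h2 : 0 ≤ l - s := by have := abs_le.mp hs; omega
  have hη : ∀ᶠ t in nhds θ, ∀ φ : ℝ, spinSphHarm s l m t φ =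
      ((spinNorm s l m * spinPolar s l m t : ℝ) : ℂ) * Complex.exp (Complex.I * m * φ) := by
    filter_upwards [Ioo_mem_nhds h0 hπ] with t ht φ
    exact spinSphHarm_eq hs hm ht.1 ht.2 φ
  rw [ethBar_of_eventuallyEq (h := fun t => spinNorm s l m * spinPolar s l m t) hη
    ((hasDerivAt_spinPolar h1 h2 m h0 hπ).const_mul _)
    (Real.sin_pos_of_pos_of_lt_pi h0 hπ).ne', spinSphHarm_eq hs1 hm h0 hπ, ← Complex.ofReal_neg,
    ← Complex.ofReal_neg, ← mul_assoc (Complex.ofReal _) (Complex.ofReal _) (Complex.exp _),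
    ← Complex.ofReal_mul]
  congr 2
  linear_combination (-spinPolar (s - 1) l m θ) * spinNorm_lowering h1 h2 m
end

section
/- Let l ≥ 0 and −l ≤ m ≤ l be integers, with the convention that Y_{l'm'} = 0 whenever l' < 0 or |m'| > l'. Then for all θ ∈ [0,π] and φ ∈ [0,2π), cos θ · Y_{lm}(θ,φ) = √(((l+1)²−m²)/((2l+1)(2l+3)))·Y_{l+1,m}(θ,φ) + √((l²−m²)/((2l−1)(2l+1)))·Y_{l−1,m}(θ,φ). -/
open scoped Real
open Complex

noncomputable section

open Polynomial in
/-- The normalized Rodrigues polynomial `(X² - 1)^l / (2^l l!)`, whose `l`-th derivative is the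
Legendre polynomial `P_l`. -/
def rodriguesPoly (l : ℕ) : ℝ[X] :=
  C (1 / (2 ^ l * (Nat.factorial l : ℝ))) * (X ^ 2 - 1) ^ l

open Polynomial in
theorem derivative_rodriguesPoly_succ (l : ℕ) :
    derivative (rodriguesPoly (l + 1)) = rodriguesPoly l * X := by
  have h : (1 / (2 ^ (l + 1) * (Nat.factorial (l + 1) : ℝ))) * ((l + 1) * 2) =
      1 / (2 ^ l * (Nat.factorial l : ℝ)) := by
    have := Nat.factorial_ne_zero l
    rw [Nat.factorial_succ]
    push_cast
    field_simp
    ring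
  rw [rodriguesPoly, rodriguesPoly, ← h]
  simp only [derivative_C_mul, derivative_pow, derivative_sub, derivative_X, derivative_one, C_mul,
    C_add, C_1, C_eq_natCast, C_ofNat, Nat.add_sub_cancel]
  push_cast
  ring

open Polynomial in
theorem X_sq_sub_one_mul_rodriguesPoly (l : ℕ) :
    (X ^ 2 - 1) * rodriguesPoly l = C (2 * (l + 1) : ℝ) * rodriguesPoly (l + 1) := by
  have h : (2 * (l + 1) : ℝ) * (1 / (2 ^ (l + 1) * (Nat.factorial (l + 1) : ℝ))) =
      1 / (2 ^ l * (Nat.factorial l : ℝ)) := by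
    have := Nat.factorial_ne_zero l
    rw [Nat.factorial_succ]
    push_cast
    field_simp
    ring
  rw [rodriguesPoly, rodriguesPoly, ← mul_assoc (C _) (C _), ← C_mul, h]
  ring

open Polynomial in
theorem iterate_derivative_two_rodriguesPoly (l : ℕ) :
    derivative (derivative (rodriguesPoly (l + 2))) =
      C (2 * (l + 1) + 1 : ℝ) * rodriguesPoly (l + 1) + rodriguesPoly l := by
  have h := X_sq_sub_one_mul_rodriguesPoly l
  rw [derivative_rodriguesPoly_succ, derivative_mul, derivative_rodriguesPoly_succ, derivative_X,
    C_add, C_1]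
  linear_combination h

open Polynomial in
theorem natDegree_rodriguesPoly_le (l : ℕ) : (rodriguesPoly l).natDegree ≤ 2 * l := by
  rw [rodriguesPoly]
  compute_degree
  omega

open Polynomial in
theorem iteratedDeriv_polynomial_eval (p : ℝ[X]) (n : ℕ) :
    iteratedDeriv n (fun x => p.eval x) = fun x => (derivative^[n] p).eval x := by
  induction n with
  | zero => simp
  | succ n ih =>
    rw [iteratedDeriv_succ, ih]
    ext x
    rw [Polynomial.deriv, Function.iterate_succ_apply']

open Polynomial in
theorem legendreP_eq_eval (l : ℕ) :
    legendreP l = fun x => (derivative^[l] (rodriguesPoly l)).eval x := by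
  ext x
  have h : (fun y : ℝ => (y ^ 2 - 1) ^ l) = fun y => ((X ^ 2 - 1 : ℝ[X]) ^ l).eval y := by
    simp
  rw [legendreP, h, iteratedDeriv_polynomial_eval, rodriguesPoly, iterate_derivative_C_mul,
    eval_C_mul]

open Polynomial in
theorem iteratedDeriv_legendreP (l m : ℕ) (x : ℝ) :
    iteratedDeriv m (legendreP l) x = (derivative^[m + l] (rodriguesPoly l)).eval x := by
  rw [legendreP_eq_eval, iteratedDeriv_polynomial_eval, Function.iterate_add_apply]

open Polynomial in
theorem iteratedDeriv_legendreP_succ (l m : ℕ) (x : ℝ) :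
    iteratedDeriv m (legendreP (l + 1)) x = x * iteratedDeriv m (legendreP l) x +
      (m + l : ℝ) * (derivative^[m + l - 1] (rodriguesPoly l)).eval x := by
  rw [iteratedDeriv_legendreP, iteratedDeriv_legendreP, ← add_assoc, Function.iterate_succ_apply,
    derivative_rodriguesPoly_succ, iterate_derivative_mul_X]
  simp
  ring

open Polynomial in
theorem iteratedDeriv_legendreP_add_two (l m : ℕ) (x : ℝ) :
    iteratedDeriv m (legendreP (l + 2)) x = iteratedDeriv m (legendreP l) x +
      (2 * (l + 1) + 1 : ℝ) * (derivative^[m + l] (rodriguesPoly (l + 1))).eval x := by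
  rw [iteratedDeriv_legendreP, iteratedDeriv_legendreP, ← add_assoc, Function.iterate_add_apply,
    Function.iterate_succ_apply, Function.iterate_one, iterate_derivative_two_rodriguesPoly,
    iterate_map_add, iterate_derivative_C_mul, eval_add, eval_C_mul]
  ring

theorem assocLegendreNat_add_two (l m : ℕ) (x : ℝ) :
    (2 * (l + 1) + 1 : ℝ) * (x * assocLegendreNat (l + 1) m x) =
      (l + 2 - m : ℝ) * assocLegendreNat (l + 2) m x +
      (l + 1 + m : ℝ) * assocLegendreNat l m x := by
  have hA := iteratedDeriv_legendreP_succ (l + 1) m x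
  have hB := iteratedDeriv_legendreP_add_two l m x
  rw [← add_assoc, Nat.add_sub_cancel] at hA
  push_cast at hA
  simp only [assocLegendreNat]
  linear_combination (-1 : ℝ) ^ m * Real.sqrt (1 - x ^ 2) ^ m *
    ((l + 1 + m : ℝ) * hB - (2 * (l + 1) + 1 : ℝ) * hA)

theorem assocLegendreNat_one_zero (x : ℝ) :
    assocLegendreNat 1 0 x = x * assocLegendreNat 0 0 x := by
  simpa [assocLegendreNat] using iteratedDeriv_legendreP_succ 0 0 x

theorem assocLegendreNat_eq_zero {l m : ℕ} (h : l < m) (x : ℝ) : assocLegendreNat l m x = 0 := by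
  rw [assocLegendreNat, iteratedDeriv_legendreP, Polynomial.iterate_derivative_eq_zero]
  · simp
  · exact (natDegree_rodriguesPoly_le l).trans_lt (by omega)

/-- The normalization constant of the spherical harmonics of degree `l` and order `n ≥ 0`. -/
def sphHarmNorm (l n : ℕ) : ℝ :=
  Real.sqrt ((2 * (l : ℝ) + 1) / (4 * Real.pi) *
    ((Nat.factorial (l - n) : ℝ) / (Nat.factorial (l + n) : ℝ)))

theorem sphHarmNorm_nonneg (l n : ℕ) : 0 ≤ sphHarmNorm l n := Real.sqrt_nonneg _

theorem sq_sphHarmNorm (l n : ℕ) : sphHarmNorm l n ^ 2 = (2 * (l : ℝ) + 1) / (4 * Real.pi) *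
    ((Nat.factorial (l - n) : ℝ) / (Nat.factorial (l + n) : ℝ)) :=
  Real.sq_sqrt (by positivity)

theorem sq_sphHarmNorm_succ {l n : ℕ} (h : n ≤ l) :
    (2 * l + 1 : ℝ) * (l + 1 + n) * sphHarmNorm (l + 1) n ^ 2 =
      (2 * l + 3) * (l + 1 - n) * sphHarmNorm l n ^ 2 := by
  obtain ⟨d, rfl⟩ := Nat.exists_eq_add_of_le h
  rw [sq_sphHarmNorm, sq_sphHarmNorm, show n + d + 1 - n = d + 1 by omega,
    show n + d - n = d by omega, show n + d + 1 + n = n + d + n + 1 by omega,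
    Nat.factorial_succ, Nat.factorial_succ]
  have := Nat.factorial_ne_zero (n + d + n)
  push_cast
  field_simp
  ring

/-- The coefficient of the three-term recursion between the degrees `l` and `l + 1`. -/
def sphHarmCoeff (l n : ℕ) : ℝ :=
  Real.sqrt ((((l : ℝ) + 1) ^ 2 - (n : ℝ) ^ 2) / ((2 * (l : ℝ) + 1) * (2 * (l : ℝ) + 3)))

theorem sq_sphHarmCoeff {l n : ℕ} (h : n ≤ l) :
    sphHarmCoeff l n ^ 2 =
      (((l : ℝ) + 1) ^ 2 - (n : ℝ) ^ 2) / ((2 * (l : ℝ) + 1) * (2 * (l : ℝ) + 3)) := by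
  have h' : (n : ℝ) ≤ l := by exact_mod_cast h
  refine Real.sq_sqrt (div_nonneg ?_ (by positivity))
  nlinarith [(Nat.cast_nonneg n : (0 : ℝ) ≤ n)]

theorem sphHarmCoeff_mul_sphHarmNorm_succ {l n : ℕ} (h : n ≤ l) :
    (2 * l + 1 : ℝ) * (sphHarmCoeff l n * sphHarmNorm (l + 1) n) =
      (l + 1 - n) * sphHarmNorm l n := by
  have h' : (n : ℝ) ≤ l := by exact_mod_cast h
  have h1 := sphHarmNorm_nonneg l n
  have h2 := sphHarmNorm_nonneg (l + 1) n
  have h3 : 0 ≤ sphHarmCoeff l n := Real.sqrt_nonneg _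
  refine (sq_eq_sq₀ (by positivity) (mul_nonneg (by linarith) h1)).1 ?_
  rw [mul_pow, mul_pow, mul_pow, sq_sphHarmCoeff h]
  have h4 := sq_sphHarmNorm_succ h
  field_simp
  linear_combination (l + 1 - n : ℝ) * h4

theorem sphHarmCoeff_mul_sphHarmNorm {l n : ℕ} (h : n ≤ l) :
    (2 * l + 3 : ℝ) * (sphHarmCoeff l n * sphHarmNorm l n) =
      (l + 1 + n) * sphHarmNorm (l + 1) n := by
  have h1 := sphHarmNorm_nonneg l n
  have h2 := sphHarmNorm_nonneg (l + 1) n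
  have h3 : 0 ≤ sphHarmCoeff l n := Real.sqrt_nonneg _
  refine (sq_eq_sq₀ (by positivity) (by positivity)).1 ?_
  rw [mul_pow, mul_pow, mul_pow, sq_sphHarmCoeff h]
  have h4 := sq_sphHarmNorm_succ h
  field_simp
  linear_combination -(l + 1 + n : ℝ) * h4

/-- The sign relating the spherical harmonics of order `m` and `|m|`. -/
def sphHarmSign (m : ℤ) : ℝ := if 0 ≤ m then 1 else (-1) ^ m.natAbs

theorem sphHarm_natCast {l : ℕ} {m : ℤ} (h : m.natAbs ≤ l) (θ φ : ℝ) :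
    sphHarm l m θ φ =
      ((sphHarmSign m * sphHarmNorm l m.natAbs * assocLegendreNat l m.natAbs (Real.cos θ) : ℝ) : ℂ)
        * Complex.exp (Complex.I * (m : ℂ) * (φ : ℂ)) := by
  rw [sphHarm, if_pos ⟨by omega, by rw [Int.abs_eq_natAbs]; omega⟩]
  congr 2
  rw [assocLegendre, sphHarmSign, sphHarmNorm, Int.toNat_natCast, Int.cast_natCast]
  split_ifs with hm
  · rw [show m.toNat = m.natAbs by omega, show ((l : ℤ) - m).toNat = l - m.natAbs by omega,
      show ((l : ℤ) + m).toNat = l + m.natAbs by omega, one_mul]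
  · rw [show ((l : ℤ) - m).toNat = l + m.natAbs by omega,
      show ((l : ℤ) + m).toNat = l - m.natAbs by omega]
    generalize (l - m.natAbs) = a
    generalize (l + m.natAbs) = b
    have ha : (0 : ℝ) < Nat.factorial a := by positivity
    have hb : (0 : ℝ) < Nat.factorial b := by positivity
    have key : Real.sqrt ((2 * (l : ℝ) + 1) / (4 * Real.pi) *
          ((Nat.factorial b : ℝ) / (Nat.factorial a : ℝ))) *
            ((Nat.factorial a : ℝ) / (Nat.factorial b : ℝ)) =
        Real.sqrt ((2 * (l : ℝ) + 1) / (4 * Real.pi) *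
          ((Nat.factorial a : ℝ) / (Nat.factorial b : ℝ))) := by
      refine (sq_eq_sq₀ (by positivity) (by positivity)).1 ?_
      rw [mul_pow, Real.sq_sqrt (by positivity), Real.sq_sqrt (by positivity)]
      field_simp
    rw [← key]
    ring

theorem sphHarm_eq_zero {l m : ℤ} (h : l < |m|) (θ φ : ℝ) : sphHarm l m θ φ = 0 :=
  if_neg fun h' => h.not_ge h'.2

end

/-- **Recursion for `cos θ · Y_{lm}`:**
`cos θ Y_{lm} = √(((l+1)²-m²)/((2l+1)(2l+3))) Y_{l+1,m} + √((l²-m²)/((2l-1)(2l+1))) Y_{l-1,m}`,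
with the convention that `Y_{l'm'} = 0` when `l' < 0` or `|m'| > l'`. -/
theorem cos_mul_sphHarm
    (l m : ℤ) (hl : 0 ≤ l) (hm : |m| ≤ l) :
    ∀ θ ∈ Set.Icc (0 : ℝ) Real.pi, ∀ φ ∈ Set.Ico (0 : ℝ) (2 * Real.pi),
      ((Real.cos θ : ℝ) : ℂ) * sphHarm l m θ φ =
        ((Real.sqrt ((((l : ℝ) + 1) ^ 2 - (m : ℝ) ^ 2) /
            ((2 * (l : ℝ) + 1) * (2 * (l : ℝ) + 3))) : ℝ) : ℂ) * sphHarm (l + 1) m θ φ +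
        ((Real.sqrt (((l : ℝ) ^ 2 - (m : ℝ) ^ 2) /
            ((2 * (l : ℝ) - 1) * (2 * (l : ℝ) + 1))) : ℝ) : ℂ) * sphHarm (l - 1) m θ φ := by
  intro θ _ φ _
  lift l to ℕ using hl
  have hm' : m.natAbs ≤ l := by rwa [Int.abs_eq_natAbs, Nat.cast_le] at hm
  have hsq : (m : ℝ) ^ 2 = (m.natAbs : ℝ) ^ 2 := by
    rw [Nat.cast_natAbs, Int.cast_abs, sq_abs]
  rw [hsq, Int.cast_natCast]
  obtain _ | k := l
  · obtain rfl : m = 0 := by omega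
    have h := sphHarmCoeff_mul_sphHarmNorm_succ (le_refl 0)
    have h1 := sphHarm_natCast (l := 0) (m := 0) le_rfl θ φ
    have h2 := sphHarm_natCast (l := 1) (m := 0) (by simp) θ φ
    have h3 := sphHarm_eq_zero (l := -1) (m := 0) (by simp) θ φ
    simp only [sphHarmCoeff] at h
    simp only [Nat.cast_zero, Nat.cast_one, Int.natAbs_zero, mul_zero, zero_add, zero_sub, one_mul,
      sub_zero, assocLegendreNat_one_zero] at *
    rw [h1, h2, h3, ← h]
    push_cast
    ring
  · have h1 := sphHarm_natCast hm' θ φ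
    have h2 := sphHarm_natCast (hm'.trans (Nat.le_succ _)) θ φ
    have hrec := assocLegendreNat_add_two k m.natAbs (Real.cos θ)
    have hup := sphHarmCoeff_mul_sphHarmNorm_succ hm'
    rw [show (((k + 1 : ℕ) : ℤ) - 1) = (k : ℤ) by push_cast; ring]
    have hcoef : Real.sqrt ((((k + 1 : ℕ) : ℝ) ^ 2 - (m.natAbs : ℝ) ^ 2) /
        ((2 * ((k + 1 : ℕ) : ℝ) - 1) * (2 * ((k + 1 : ℕ) : ℝ) + 1))) =
          sphHarmCoeff k m.natAbs := by
      rw [sphHarmCoeff]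
      push_cast
      congr 3 <;> ring
    have hlow : ((sphHarmCoeff k m.natAbs : ℝ) : ℂ) * sphHarm k m θ φ * (2 * (k + 1) + 1) =
        ((sphHarmSign m * ((k + 1 + m.natAbs) * sphHarmNorm (k + 1) m.natAbs) *
          assocLegendreNat k m.natAbs (Real.cos θ) : ℝ) : ℂ) *
            Complex.exp (Complex.I * (m : ℂ) * (φ : ℂ)) := by
      by_cases hk : m.natAbs ≤ k
      · rw [← sphHarmCoeff_mul_sphHarmNorm hk, sphHarm_natCast hk]
        push_cast
        ring
      · rw [sphHarm_eq_zero (by rw [Int.abs_eq_natAbs]; omega), assocLegendreNat_eq_zero (by omega)]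
        simp
    have hne : (2 * (k + 1) + 1 : ℂ) ≠ 0 := by exact_mod_cast Nat.succ_ne_zero (2 * (k + 1))
    rw [hcoef, ← sphHarmCoeff, show (((k + 1 : ℕ) : ℤ) + 1) = ((k + 1 + 1 : ℕ) : ℤ) by push_cast; ring,
      h1, h2]
    refine mul_right_cancel₀ hne ?_
    rw [add_mul, hlow]
    have hreal := congrArg (fun t : ℝ => (t : ℂ) * Complex.exp (Complex.I * (m : ℂ) * (φ : ℂ)))
      (show Real.cos θ * (sphHarmSign m * sphHarmNorm (k + 1) m.natAbs *
          assocLegendreNat (k + 1) m.natAbs (Real.cos θ)) * (2 * (k + 1) + 1) =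
        sphHarmCoeff (k + 1) m.natAbs * (sphHarmSign m * sphHarmNorm (k + 1 + 1) m.natAbs *
          assocLegendreNat (k + 1 + 1) m.natAbs (Real.cos θ)) * (2 * (k + 1) + 1) +
        sphHarmSign m * ((k + 1 + m.natAbs) * sphHarmNorm (k + 1) m.natAbs) *
          assocLegendreNat k m.natAbs (Real.cos θ) by
        push_cast at hup
        linear_combination sphHarmSign m * sphHarmNorm (k + 1) m.natAbs * hrec -
          sphHarmSign m * assocLegendreNat (k + 2) m.natAbs (Real.cos θ) * hup)
    push_cast at hreal ⊢
    linear_combination hreal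
end
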